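/- arXiv:2102.10654 — 7 statements merged into one kernel-verified Lean document; each statement's English description precedes it below -/
import Mathlib

section
/- Let X be a partial allocation for 3 agents whose valuations are non-degenerate and cancelable, such that at least one item is unallocated and no agent envies another agent. Then there exists a partial EFX allocation Y that Pareto dominates X. -/
namespace FairDivision

open Finset

/-- A valuation: nonnegative, zero on the empty set, monotone. -/
def IsValuation {ι : Type*} (v : Finset ι → ℝ) : Prop :=
  v ∅ = 0 ∧ (∀ S : Finset ι, 0 ≤ v S) ∧ ∀ ⦃S T : Finset ι⦄, S ⊆ T → v S ≤ v T

/-- `v` is cancelable: `v (S ∪ {g}) > v (T ∪ {g})` implies `v S > v T`. -/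
def Cancelable {ι : Type*} [DecidableEq ι] (v : Finset ι → ℝ) : Prop :=
  ∀ S T : Finset ι, ∀ g : ι, g ∉ S → g ∉ T →
    v (insert g S) > v (insert g T) → v S > v T

/-- `v` is non-degenerate: distinct bundles have distinct values. -/
def NonDegenerate {ι : Type*} (v : Finset ι → ℝ) : Prop :=
  ∀ S T : Finset ι, S ≠ T → v S ≠ v T

/-- `v'` respects `v`: every strict inequality of `v` is a strict inequality of `v'`. -/
def Respects {ι : Type*} (v' v : Finset ι → ℝ) : Prop :=
  ∀ S T : Finset ι, v S > v T → v' S > v' T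

/-- `v` is a nice cancelable valuation: cancelable, and some non-degenerate
cancelable valuation respects it. -/
def NiceCancelable {ι : Type*} [DecidableEq ι] (v : Finset ι → ℝ) : Prop :=
  Cancelable v ∧ ∃ v' : Finset ι → ℝ,
    IsValuation v' ∧ NonDegenerate v' ∧ Cancelable v' ∧ Respects v' v

/-- A partial allocation: the bundles are pairwise disjoint. -/
def IsPartialAlloc {ι : Type*} {n : ℕ} (X : Fin n → Finset ι) : Prop :=
  ∀ i j : Fin n, i ≠ j → Disjoint (X i) (X j)

/-- The set of unallocated items. -/
def unalloc {ι : Type*} [DecidableEq ι] [Fintype ι] {n : ℕ}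
    (X : Fin n → Finset ι) : Finset ι :=
  Finset.univ \ Finset.univ.biUnion X

/-- Agent `i` envies the set `S`. -/
def EnviesSet {ι : Type*} {n : ℕ} (v : Fin n → Finset ι → ℝ) (X : Fin n → Finset ι)
    (i : Fin n) (S : Finset ι) : Prop :=
  v i (X i) < v i S

/-- Agent `i` strongly envies the set `S`. -/
def StrongEnviesSet {ι : Type*} [DecidableEq ι] {n : ℕ} (v : Fin n → Finset ι → ℝ)
    (X : Fin n → Finset ι) (i : Fin n) (S : Finset ι) : Prop :=
  ∃ h ∈ S, v i (X i) < v i (S.erase h)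

/-- The allocation is EFX: no agent strongly envies another agent's bundle. -/
def IsEFX {ι : Type*} [DecidableEq ι] {n : ℕ} (v : Fin n → Finset ι → ℝ)
    (X : Fin n → Finset ι) : Prop :=
  ∀ i j : Fin n, i ≠ j → ¬ StrongEnviesSet v X i (X j)

/-- `Y` Pareto dominates `X`. -/
def ParetoDominates {ι : Type*} {n : ℕ} (v : Fin n → Finset ι → ℝ)
    (Y X : Fin n → Finset ι) : Prop :=
  (∀ i, v i (X i) ≤ v i (Y i)) ∧ ∃ i, v i (X i) < v i (Y i)

/-- `Y` dominates `X` lexicographically with respect to the ordering `a` of the agents. -/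
def Dominates {ι : Type*} {n : ℕ} (v : Fin n → Finset ι → ℝ) (a : Fin n → Fin n)
    (Y X : Fin n → Finset ι) : Prop :=
  ∃ k : Fin n, (∀ j : Fin n, j < k → v (a j) (Y (a j)) = v (a j) (X (a j))) ∧
    v (a k) (X (a k)) < v (a k) (Y (a k))

/-- Agent `i` is a most envious agent of the set `S`: there is `T ⊆ S` that `i`
envies and that no agent strongly envies.  (`S \ T` is a corresponding discard set.) -/
def MostEnvious {ι : Type*} [DecidableEq ι] {n : ℕ} (v : Fin n → Finset ι → ℝ)
    (X : Fin n → Finset ι) (i : Fin n) (S : Finset ι) : Prop :=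
  ∃ T ⊆ S, EnviesSet v X i T ∧ ∀ j : Fin n, ¬ StrongEnviesSet v X j T

/-- `i` champions `j` with respect to the item `g`:  `i` is a most envious agent
of `X j ∪ {g}`. -/
def ChampG {ι : Type*} [DecidableEq ι] {n : ℕ} (v : Fin n → Finset ι → ℝ)
    (X : Fin n → Finset ι) (g : ι) (i j : Fin n) : Prop :=
  MostEnvious v X i (insert g (X j))

/-- `i` champions `j` with respect to `(H | S)`:  `H ⊆ M \ X j`, `S ⊆ X j`, and `i`
is a most envious agent of `(X j \ S) ∪ H`. -/
def GenChamp {ι : Type*} [DecidableEq ι] {n : ℕ} (v : Fin n → Finset ι → ℝ)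
    (X : Fin n → Finset ι) (i j : Fin n) (H S : Finset ι) : Prop :=
  Disjoint H (X j) ∧ S ⊆ X j ∧ MostEnvious v X i ((X j \ S) ∪ H)

section Cancel

variable {ι : Type*} [DecidableEq ι] {v : Finset ι → ℝ}

lemma Cancelable.lt_of_union_lt (hc : Cancelable v) {R S T : Finset ι}
    (hS : Disjoint R S) (hT : Disjoint R T) (h : v (R ∪ S) < v (R ∪ T)) : v S < v T := by
  induction R using Finset.induction_on with
  | empty => simpa using h
  | insert a R ha ih =>
    rw [disjoint_insert_left] at hS hT
    rw [insert_union, insert_union] at h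
    exact ih hS.2 hT.2 (hc _ _ a (by simp [ha, hT.1]) (by simp [ha, hS.1]) h)

lemma Cancelable.union_le_union (hc : Cancelable v) {R S T : Finset ι}
    (hS : Disjoint R S) (hT : Disjoint R T) (h : v S ≤ v T) : v (R ∪ S) ≤ v (R ∪ T) := by
  by_contra! h'
  exact absurd (hc.lt_of_union_lt hT hS h') (not_lt.2 h)

lemma Cancelable.union_le_union_right (hc : Cancelable v) {R S T : Finset ι}
    (hS : Disjoint S R) (hT : Disjoint T R) (h : v S ≤ v T) : v (S ∪ R) ≤ v (T ∪ R) := by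
  rw [union_comm S, union_comm T]
  exact hc.union_le_union hS.symm hT.symm h

lemma Cancelable.lt_of_union_lt_right (hc : Cancelable v) {R S T : Finset ι}
    (hS : Disjoint S R) (hT : Disjoint T R) (h : v (S ∪ R) < v (T ∪ R)) : v S < v T := by
  rw [union_comm S, union_comm T] at h
  exact hc.lt_of_union_lt hS.symm hT.symm h

end Cancel

lemma eq_or_eq_or_eq_of_ne : ∀ i j k : Fin 3, i ≠ j → j ≠ k → i ≠ k →
    ∀ a, a = i ∨ a = j ∨ a = k := by
  decide

section Alloc

variable {ι : Type*} [DecidableEq ι] {v : Fin 3 → Finset ι → ℝ} {X : Fin 3 → Finset ι}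

/-- No agent strongly envies `S`. -/
def Safe (v : Fin 3 → Finset ι → ℝ) (X : Fin 3 → Finset ι) (S : Finset ι) : Prop :=
  ∀ a, ¬ StrongEnviesSet v X a S

/-- `X` is Pareto dominated by a partial EFX allocation. -/
def Improvable (v : Fin 3 → Finset ι → ℝ) (X : Fin 3 → Finset ι) : Prop :=
  ∃ Y : Fin 3 → Finset ι, IsPartialAlloc Y ∧ IsEFX v Y ∧ ParetoDominates v Y X

/-- The allocation giving `P` to `i`, `Q` to `j` and `R` to the remaining agent. -/
def assign (i j : Fin 3) (P Q R : Finset ι) : Fin 3 → Finset ι :=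
  fun a => if a = i then P else if a = j then Q else R

omit [DecidableEq ι] in
lemma isPartialAlloc_assign {i j k : Fin 3} (hij : i ≠ j) (hjk : j ≠ k) (hik : i ≠ k)
    {P Q R : Finset ι} (hPQ : Disjoint P Q) (hQR : Disjoint Q R) (hPR : Disjoint P R) :
    IsPartialAlloc (assign i j P Q R) := by
  intro a b hab
  obtain rfl | rfl | rfl := eq_or_eq_or_eq_of_ne i j k hij hjk hik a <;>
  obtain rfl | rfl | rfl := eq_or_eq_or_eq_of_ne _ _ _ hij hjk hik b <;>
  simp_all [assign, hij.symm, hjk.symm, hik.symm, disjoint_comm]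

lemma improvable_of_safe {i j k : Fin 3} (hij : i ≠ j) (hjk : j ≠ k) (hik : i ≠ k)
    {P Q R : Finset ι} (hPQ : Disjoint P Q) (hQR : Disjoint Q R) (hPR : Disjoint P R)
    (sP : Safe v X P) (sQ : Safe v X Q) (sR : Safe v X R)
    (hP : EnviesSet v X i P) (hQ : v j (X j) ≤ v j Q) (hR : v k (X k) ≤ v k R) :
    Improvable v X := by
  have hi : assign i j P Q R i = P := by simp [assign]
  have hj : assign i j P Q R j = Q := by simp [assign, hij.symm]
  have hk : assign i j P Q R k = R := by simp [assign, hjk.symm, hik.symm]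
  have hle : ∀ a, v a (X a) ≤ v a (assign i j P Q R a) := by
    intro a
    obtain rfl | rfl | rfl := eq_or_eq_or_eq_of_ne i j k hij hjk hik a
    · rw [hi]; exact le_of_lt hP
    · rwa [hj]
    · rwa [hk]
  have hsafe : ∀ a, Safe v X (assign i j P Q R a) := by
    intro a
    obtain rfl | rfl | rfl := eq_or_eq_or_eq_of_ne i j k hij hjk hik a
    · rwa [hi]
    · rwa [hj]
    · rwa [hk]
  refine ⟨assign i j P Q R, isPartialAlloc_assign hij hjk hik hPQ hQR hPR, ?_, hle, i, ?_⟩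
  · rintro a b - ⟨h, hh, hlt⟩
    exact hsafe b a ⟨h, hh, (hle a).trans_lt hlt⟩
  · rw [hi]; exact hP

lemma improvable_of_envyFree (hval : ∀ i, IsValuation (v i)) {i j k : Fin 3}
    (hij : i ≠ j) (hjk : j ≠ k) (hik : i ≠ k)
    {P Q R : Finset ι} (hPQ : Disjoint P Q) (hQR : Disjoint Q R) (hPR : Disjoint P R)
    (hP : EnviesSet v X i P) (hQ : EnviesSet v X j Q) (hR : EnviesSet v X k R)
    (hiP : v i Q ≤ v i P ∧ v i R ≤ v i P) (hjQ : v j R ≤ v j Q ∧ v j P ≤ v j Q)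
    (hkR : v k P ≤ v k R ∧ v k Q ≤ v k R) :
    Improvable v X := by
  have hi : assign i j P Q R i = P := by simp [assign]
  have hj : assign i j P Q R j = Q := by simp [assign, hij.symm]
  have hk : assign i j P Q R k = R := by simp [assign, hjk.symm, hik.symm]
  refine ⟨assign i j P Q R, isPartialAlloc_assign hij hjk hik hPQ hQR hPR, ?_, ?_, i, ?_⟩
  · rintro a b - ⟨h, -, hlt⟩
    refine absurd (hlt.trans_le ((hval a).2.2 (erase_subset h _))) (not_lt.2 ?_)
    obtain rfl | rfl | rfl := eq_or_eq_or_eq_of_ne i j k hij hjk hik a <;>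
    obtain rfl | rfl | rfl := eq_or_eq_or_eq_of_ne _ _ _ hij hjk hik b <;>
    simp only [hi, hj, hk, le_refl, hiP, hjQ, hkR]
  · intro a
    obtain rfl | rfl | rfl := eq_or_eq_or_eq_of_ne i j k hij hjk hik a
    · rw [hi]; exact le_of_lt hP
    · rw [hj]; exact le_of_lt hQ
    · rw [hk]; exact le_of_lt hR
  · rw [hi]; exact hP

omit [DecidableEq ι] in
lemma EnviesSet.mono (hval : ∀ i, IsValuation (v i)) {i : Fin 3} {S T : Finset ι}
    (h : EnviesSet v X i S) (hST : S ⊆ T) : EnviesSet v X i T :=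
  lt_of_lt_of_le h ((hval i).2.2 hST)

/-- An envied set contains an envied set that nobody strongly envies. -/
lemma exists_safe_subset {a : Fin 3} {S : Finset ι} (h : EnviesSet v X a S) :
    ∃ T ⊆ S, Safe v X T ∧ ∃ b, EnviesSet v X b T := by
  induction S using Finset.strongInduction generalizing a with
  | H S ih =>
    by_cases hs : Safe v X S
    · exact ⟨S, Subset.rfl, hs, a, h⟩
    · simp only [Safe, not_forall, not_not] at hs
      obtain ⟨b, x, hx, hb⟩ := hs
      obtain ⟨T, hT, hT'⟩ := ih _ (erase_ssubset hx) hb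
      exact ⟨T, hT.trans (erase_subset _ _), hT'⟩

lemma safe_bundle (hval : ∀ i, IsValuation (v i))
    (hEF : ∀ i j : Fin 3, i ≠ j → ¬ EnviesSet v X i (X j)) (j : Fin 3) : Safe v X (X j) := by
  rintro a ⟨h, -, hlt⟩
  have h' : EnviesSet v X a (X j) := EnviesSet.mono hval hlt (erase_subset _ _)
  by_cases haj : a = j
  · subst haj; exact lt_irrefl _ h'
  · exact hEF a j haj h'

/-- Every bundle `X j` is split as `T j ∪ B j`, where nobody strongly envies `T j ∪ {g}`
for the unallocated item `g`, and its owner `j` does not envy it. -/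
structure Split (v : Fin 3 → Finset ι → ℝ) (X T B : Fin 3 → Finset ι) (g : ι) : Prop where
  val : ∀ i, IsValuation (v i)
  nondeg : ∀ i, NonDegenerate (v i)
  canc : ∀ i, Cancelable (v i)
  efree : ∀ i j, i ≠ j → ¬ EnviesSet v X i (X j)
  eq_union : ∀ j, X j = T j ∪ B j
  disj : ∀ i j, Disjoint (T i) (B j)
  disjT : ∀ i j, i ≠ j → Disjoint (T i) (T j)
  disjB : ∀ i j, i ≠ j → Disjoint (B i) (B j)
  gT : ∀ i, Disjoint (T i) {g}
  gB : ∀ i, Disjoint (B i) {g}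
  safe : ∀ j, Safe v X (T j ∪ {g})
  not_self : ∀ j, ¬ EnviesSet v X j (T j ∪ {g})

namespace Split

variable {T B : Fin 3 → Finset ι} {g : ι} {i j k : Fin 3}

lemma le_of_split (h : Split v X T B g) (i j : Fin 3) : v i (T j ∪ B j) ≤ v i (X i) := by
  rw [← h.eq_union]
  by_cases hij : i = j
  · rw [hij]
  · exact not_lt.1 (h.efree i j hij)

lemma g_lt_own (h : Split v X T B g) (j : Fin 3) : v j {g} < v j (B j) := by
  have h1 : v j (T j ∪ {g}) ≤ v j (T j ∪ B j) := by
    rw [← h.eq_union]; exact not_lt.1 (h.not_self j)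
  refine (h.canc j).lt_of_union_lt (h.gT j) (h.disj j j) (lt_of_le_of_ne h1 (h.nondeg j _ _ ?_))
  intro he
  have hg : g ∈ T j ∪ B j := he ▸ by simp
  rcases mem_union.1 hg with hg | hg
  · exact disjoint_singleton_right.1 (h.gT j) hg
  · exact disjoint_singleton_right.1 (h.gB j) hg

lemma lt_g (h : Split v X T B g) (e : EnviesSet v X i (T j ∪ {g})) : v i (B j) < v i {g} :=
  (h.canc i).lt_of_union_lt (h.disj j j) (h.gT j) ((h.le_of_split i j).trans_lt e)

lemma envies_B (h : Split v X T B g) (m : Fin 3) (e : EnviesSet v X i (T j ∪ {g}))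
    (hm : v i {g} ≤ v i (B m)) : EnviesSet v X i (T j ∪ B m) :=
  lt_of_lt_of_le e ((h.canc i).union_le_union (h.gT j) (h.disj j m) hm)

lemma envies_g (h : Split v X T B g) {m : Fin 3} (e : EnviesSet v X i (T j ∪ B m))
    (hm : v i (B m) ≤ v i {g}) : EnviesSet v X i (T j ∪ {g}) :=
  lt_of_lt_of_le e ((h.canc i).union_le_union (h.disj j m) (h.gT j) hm)

lemma envies_own (h : Split v X T B g) (e : EnviesSet v X i (T j ∪ {g})) :
    EnviesSet v X i (T j ∪ B i) :=
  h.envies_B i e (h.g_lt_own i).le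

lemma lt_of_envies_self (h : Split v X T B g) {m : Fin 3} (e : EnviesSet v X i (T i ∪ B m)) :
    v i (B i) < v i (B m) :=
  (h.canc i).lt_of_union_lt (h.disj i i) (h.disj i m) ((h.le_of_split i i).trans_lt e)

lemma top_lt (h : Split v X T B g) (ej : EnviesSet v X i (T j ∪ {g}))
    (ek : ¬ EnviesSet v X i (T k ∪ {g})) : v i (T k) < v i (T j) :=
  (h.canc i).lt_of_union_lt_right (h.gT k) (h.gT j) (lt_of_le_of_lt (not_lt.1 ek) ej)

lemma disj_TB (h : Split v X T B g) {a b c d : Fin 3} (hac : a ≠ c) (hbd : b ≠ d) :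
    Disjoint (T a ∪ B b) (T c ∪ B d) := by
  simp only [disjoint_union_left, disjoint_union_right]
  exact ⟨⟨h.disjT _ _ hac, (h.disj _ _).symm⟩, h.disj _ _, h.disjB _ _ hbd⟩

lemma disj_Tg (h : Split v X T B g) {a b c : Fin 3} (hac : a ≠ c) :
    Disjoint (T a ∪ B b) (T c ∪ {g}) := by
  simp only [disjoint_union_left, disjoint_union_right]
  exact ⟨⟨h.disjT _ _ hac, (h.disj _ _).symm⟩, h.gT _, h.gB _⟩

lemma improvable_of_two_cycle_of_not_envies (h : Split v X T B g)
    (hij : i ≠ j) (hjk : j ≠ k) (hik : i ≠ k)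
    (eij : EnviesSet v X i (T j ∪ {g})) (eji : EnviesSet v X j (T i ∪ {g}))
    (hk : ¬ EnviesSet v X k (T j ∪ B i)) : Improvable v X := by
  obtain ⟨S, hS, sS, b, hb⟩ := exists_safe_subset (h.envies_own eij)
  have hb' := hb.mono h.val hS
  obtain rfl | rfl | rfl := eq_or_eq_or_eq_of_ne i j k hij hjk hik b
  · refine improvable_of_safe hij hjk hik (Q := T b ∪ {g}) (R := X k)
      ((h.disj_Tg hij.symm).mono_left hS) ?_ ?_ sS (h.safe b)
      (safe_bundle h.val h.efree k) hb eji.le le_rfl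
    · rw [h.eq_union]; exact (h.disj_Tg hik.symm).symm
    · rw [h.eq_union]; exact (h.disj_TB hjk hik).mono_left hS
  · exact absurd ((h.lt_of_envies_self hb').trans (h.lt_g eji)) (h.g_lt_own b).not_gt
  · exact absurd hb' hk

lemma improvable_of_two_cycle (h : Split v X T B g)
    (hij : i ≠ j) (hjk : j ≠ k) (hik : i ≠ k)
    (eij : EnviesSet v X i (T j ∪ {g})) (eji : EnviesSet v X j (T i ∪ {g})) :
    Improvable v X := by
  by_cases h1 : EnviesSet v X k (T j ∪ B i)
  · by_cases h2 : EnviesSet v X k (T i ∪ B j)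
    · have a1 := (h.canc k).lt_of_union_lt_right (h.disj i i) (h.disj j i)
        ((h.le_of_split k i).trans_lt h1)
      have a2 := (h.canc k).lt_of_union_lt_right (h.disj j j) (h.disj i j)
        ((h.le_of_split k j).trans_lt h2)
      exact absurd a1 a2.not_gt
    · exact h.improvable_of_two_cycle_of_not_envies hij.symm hik hjk eji eij h2
  · exact h.improvable_of_two_cycle_of_not_envies hij hjk hik eij eji h1

lemma improvable_of_three_cycle_of_le (h : Split v X T B g)
    (hij : i ≠ j) (hjk : j ≠ k) (hik : i ≠ k)
    (eij : EnviesSet v X i (T j ∪ {g})) (ejk : EnviesSet v X j (T k ∪ {g}))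
    (eki : EnviesSet v X k (T i ∪ {g})) (nkj : ¬ EnviesSet v X k (T j ∪ {g}))
    (nji : ¬ EnviesSet v X j (T i ∪ {g})) (hle : v i (B k) ≤ v i (B i)) :
    Improvable v X := by
  obtain ⟨Z, hZ, sZ, b, hb⟩ := exists_safe_subset (h.envies_own eki)
  have hb' := hb.mono h.val hZ
  obtain rfl | rfl | rfl := eq_or_eq_or_eq_of_ne i j k hij hjk hik b
  · exact absurd (h.lt_of_envies_self hb') hle.not_gt
  · exact absurd (h.envies_g hb' (h.lt_g ejk).le) nji
  obtain ⟨W, hW, sW, c, hc⟩ := exists_safe_subset (h.envies_own eij)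
  have hc' := hc.mono h.val hW
  obtain rfl | rfl | rfl := eq_or_eq_or_eq_of_ne i j b hij hjk hik c
  · exact improvable_of_safe hij hjk hik (Q := T b ∪ {g})
      ((h.disj_Tg hjk).mono_left hW) ((h.disj_Tg hik).mono_left hZ).symm
      (((h.disj_TB hij.symm hik).mono_left hW).mono_right hZ)
      sW (h.safe b) sZ hc ejk.le hb.le
  · obtain ⟨V, hV, sV, d, hd⟩ := exists_safe_subset
      (h.envies_B i ejk ((h.g_lt_own c).trans (h.lt_of_envies_self hc')).le)
    have hd' := hd.mono h.val hV
    have hVZ : Disjoint V Z := ((h.disj_TB hik.symm hik).mono_left hV).mono_right hZ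
    obtain rfl | rfl | rfl := eq_or_eq_or_eq_of_ne i c b hij hjk hik d
    · refine improvable_of_safe hij hjk hik (Q := X c) ?_ ?_ hVZ
        sV (safe_bundle h.val h.efree c) sZ hd le_rfl hb.le
      · rw [h.eq_union]; exact (h.disj_TB hjk.symm hij).mono_left hV
      · rw [h.eq_union]; exact (h.disj_TB hij.symm hjk).mono_right hZ
    · exact improvable_of_safe hjk hik.symm hij.symm (R := T d ∪ {g}) hVZ
        ((h.disj_Tg hij).mono_left hZ) ((h.disj_Tg hjk.symm).mono_left hV)
        sV sZ (h.safe d) hd hb.le eij.le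
    · exact absurd ((h.lt_of_envies_self hd').trans (h.lt_g eki)) (h.g_lt_own d).not_gt
  · exact absurd (h.envies_g hc' (h.lt_g eki).le) nkj

/-- In a three-cycle, an agent preferring its predecessor's lower half is best off with the
upper half of its successor and the lower half of its predecessor. -/
lemma best_bundle (h : Split v X T B g) (eij : EnviesSet v X i (T j ∪ {g}))
    (nik : ¬ EnviesSet v X i (T k ∪ {g})) (hlt : v i (B i) < v i (B k)) :
    EnviesSet v X i (T j ∪ B k) ∧ v i (T k ∪ B i) ≤ v i (T j ∪ B k) ∧
      v i (T i ∪ B j) ≤ v i (T j ∪ B k) := by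
  have hgi := h.g_lt_own i
  have key : ∀ a m, v i (T a) ≤ v i (T j) → v i (B m) ≤ v i (B k) →
      v i (T a ∪ B m) ≤ v i (T j ∪ B k) := fun a m ha hm =>
    ((h.canc i).union_le_union (h.disj a m) (h.disj a k) hm).trans
      ((h.canc i).union_le_union_right (h.disj a k) (h.disj j k) ha)
  exact ⟨h.envies_B k eij (hgi.trans hlt).le, key k i (h.top_lt eij nik).le hlt.le,
    key i j (h.top_lt eij (h.not_self i)).le (((h.lt_g eij).trans hgi).trans hlt).le⟩

lemma improvable_of_three_cycle (h : Split v X T B g)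
    (hij : i ≠ j) (hjk : j ≠ k) (hik : i ≠ k)
    (eij : EnviesSet v X i (T j ∪ {g})) (ejk : EnviesSet v X j (T k ∪ {g}))
    (eki : EnviesSet v X k (T i ∪ {g})) : Improvable v X := by
  by_cases nji : EnviesSet v X j (T i ∪ {g})
  · exact h.improvable_of_two_cycle hij hjk hik eij nji
  by_cases nkj : EnviesSet v X k (T j ∪ {g})
  · exact h.improvable_of_two_cycle hjk hik.symm hij.symm ejk nkj
  by_cases nik : EnviesSet v X i (T k ∪ {g})
  · exact h.improvable_of_two_cycle hik hjk.symm hij nik eki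
  rcases le_or_gt (v i (B k)) (v i (B i)) with hi | hi
  · exact h.improvable_of_three_cycle_of_le hij hjk hik eij ejk eki nkj nji hi
  rcases le_or_gt (v j (B i)) (v j (B j)) with hj | hj
  · exact h.improvable_of_three_cycle_of_le hjk hik.symm hij.symm ejk eki eij nik nkj hj
  rcases le_or_gt (v k (B j)) (v k (B k)) with hk | hk
  · exact h.improvable_of_three_cycle_of_le hik.symm hij hjk.symm eki eij ejk nji nik hk
  obtain ⟨ei, bi⟩ := h.best_bundle eij nik hi
  obtain ⟨ej, bj⟩ := h.best_bundle ejk nji hj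
  obtain ⟨ek, bk⟩ := h.best_bundle eki nkj hk
  exact improvable_of_envyFree h.val hij hjk hik (h.disj_TB hjk hik.symm)
    (h.disj_TB hik.symm hij) (h.disj_TB hij.symm hjk.symm) ei ej ek bi bj bk

/-- If each `T j ∪ {g}` is envied by some agent then `X` is improvable. -/
lemma improvable (h : Split v X T B g) (hch : ∀ j, ∃ i, EnviesSet v X i (T j ∪ {g})) :
    Improvable v X := by
  have hch' : ∀ i j k : Fin 3, i ≠ j → j ≠ k → i ≠ k →
      EnviesSet v X j (T i ∪ {g}) ∨ EnviesSet v X k (T i ∪ {g}) := by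
    intro i j k hij hjk hik
    obtain ⟨a, ha⟩ := hch i
    obtain rfl | rfl | rfl := eq_or_eq_or_eq_of_ne i j k hij hjk hik a
    · exact absurd ha (h.not_self a)
    · exact Or.inl ha
    · exact Or.inr ha
  have h01 : (0 : Fin 3) ≠ 1 := by decide
  have h02 : (0 : Fin 3) ≠ 2 := by decide
  have h12 : (1 : Fin 3) ≠ 2 := by decide
  rcases hch' 0 1 2 h01 h12 h02 with e0 | e0 <;>
  rcases hch' 1 0 2 h01.symm h02 h12 with e1 | e1 <;>
  rcases hch' 2 0 1 h02.symm h01 h12.symm with e2 | e2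
  · exact h.improvable_of_two_cycle h01 h12 h02 e1 e0
  · exact h.improvable_of_two_cycle h01 h12 h02 e1 e0
  · exact h.improvable_of_three_cycle h02 h12.symm h01 e2 e1 e0
  · exact h.improvable_of_two_cycle h12 h02.symm h01.symm e2 e1
  · exact h.improvable_of_two_cycle h02 h12.symm h01 e2 e0
  · exact h.improvable_of_three_cycle h01 h12 h02 e1 e2 e0
  · exact h.improvable_of_two_cycle h02 h12.symm h01 e2 e0
  · exact h.improvable_of_two_cycle h12 h02.symm h01.symm e2 e1

end Split

lemma improvable_of_safe_self (hval : ∀ i, IsValuation (v i)) (hX : IsPartialAlloc X)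
    (hEF : ∀ i j : Fin 3, i ≠ j → ¬ EnviesSet v X i (X j)) {g : ι} (hg : ∀ i, g ∉ X i)
    {j : Fin 3} {S : Finset ι} (hS : S ⊆ insert g (X j)) (sS : Safe v X S)
    (e : EnviesSet v X j S) : Improvable v X := by
  obtain ⟨k, l, hjk, hkl, hjl⟩ : ∃ k l : Fin 3, j ≠ k ∧ k ≠ l ∧ j ≠ l := by
    clear hS e
    revert j
    decide
  have hd : ∀ a, j ≠ a → Disjoint S (X a) := fun a ha =>
    (disjoint_insert_left.2 ⟨hg a, hX j a ha⟩).mono_left hS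
  exact improvable_of_safe hjk hkl hjl (hd k hjk) (hX k l hkl) (hd l hjl) sS
    (safe_bundle hval hEF k) (safe_bundle hval hEF l) e le_rfl le_rfl

end Alloc

/-- If `X` is a partial allocation for 3 agents with non-degenerate
cancelable valuations, at least one item is unallocated, and no agent envies
another agent, then some partial EFX allocation `Y` Pareto dominates `X`. -/
theorem three_agents_envy_free_pareto_dominating
    {ι : Type*} [DecidableEq ι] [Fintype ι]
    (v : Fin 3 → Finset ι → ℝ) (hval : ∀ i, IsValuation (v i))
    (hnd : ∀ i, NonDegenerate (v i)) (hc : ∀ i, Cancelable (v i))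
    (X : Fin 3 → Finset ι) (hX : IsPartialAlloc X)
    (hU : 1 ≤ (unalloc X).card)
    (hEF : ∀ i j : Fin 3, i ≠ j → ¬ EnviesSet v X i (X j)) :
    ∃ Y : Fin 3 → Finset ι, IsPartialAlloc Y ∧ IsEFX v Y ∧ ParetoDominates v Y X := by
  obtain ⟨g, hgU⟩ := card_pos.1 hU
  have hg : ∀ i, g ∉ X i := by simpa [unalloc] using hgU
  have hcand : ∀ j, ∃ S ⊆ insert g (X j), Safe v X S ∧ ∃ b, EnviesSet v X b S := by
    intro j
    refine exists_safe_subset (a := j) (lt_of_le_of_ne ((hval j).2.2 (subset_insert _ _))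
      (hnd j _ _ fun he => hg j ?_))
    rw [he]; exact mem_insert_self _ _
  choose S hS sS hb using hcand
  by_cases hself : ∃ j, EnviesSet v X j (S j)
  · obtain ⟨j, e⟩ := hself
    exact improvable_of_safe_self hval hX hEF hg (hS j) (sS j) e
  push Not at hself
  have hgS : ∀ j, g ∈ S j := by
    intro j
    by_contra hn
    obtain ⟨b, e⟩ := hb j
    have hbj : b ≠ j := by rintro rfl; exact hself b e
    exact hEF b j hbj (e.mono hval ((subset_insert_iff_of_notMem hn).1 (hS j)))
  have hTS : ∀ j, (S j).erase g ∪ {g} = S j := by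
    intro j; rw [union_comm, ← insert_eq, insert_erase (hgS j)]
  have hTX : ∀ j, (S j).erase g ⊆ X j := fun j => subset_insert_iff.1 (hS j)
  have hsplit : Split v X (fun j => (S j).erase g) (fun j => X j \ S j) g :=
    { val := hval
      nondeg := hnd
      canc := hc
      efree := hEF
      eq_union := by
        intro j
        ext x
        have h1 := @hTX j x
        have h2 := hg j
        grind
      disj := by
        intro i j
        by_cases hij : i = j
        · subst hij
          exact disjoint_sdiff.mono_left (erase_subset _ _)
        · exact (hX i j hij).mono (hTX i) sdiff_subset
      disjT := fun i j hij => (hX i j hij).mono (hTX i) (hTX j)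
      disjB := fun i j hij => (hX i j hij).mono sdiff_subset sdiff_subset
      gT := by simp
      gB := by intro i; simp [hg i]
      safe := by intro j; simpa only [hTS] using sS j
      not_self := by intro j; simpa only [hTS] using hself j }
  refine hsplit.improvable fun j => ?_
  simpa only [hTS] using hb j

end FairDivision
end

section
/- Let v_a and v_b be two nice cancelable valuations over the item set M, and consider n agents each of whose valuation equals v_a or v_b. Then a complete EFX allocation exists. -/
namespace FairDivision

open Finset

section Valuations

variable {ι : Type*} [DecidableEq ι] {v : Finset ι → ℝ}

theorem Cancelable.lt_of_union_lt_union (hc : Cancelable v) {S T : Finset ι} (A : Finset ι)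
    (hS : Disjoint A S) (hT : Disjoint A T) (h : v (A ∪ T) < v (A ∪ S)) : v T < v S := by
  induction A using Finset.induction_on with
  | empty => simpa using h
  | insert g A hg ih =>
    rw [disjoint_insert_left] at hS hT
    rw [insert_union, insert_union] at h
    exact ih hS.2 hT.2 (hc _ _ g (by simp [hg, hS.1]) (by simp [hg, hT.1]) h)

theorem Cancelable.union_lt_union (hc : Cancelable v) (hnd : NonDegenerate v) {S T : Finset ι}
    (A : Finset ι) (hS : Disjoint A S) (hT : Disjoint A T) (h : v T < v S) :
    v (A ∪ T) < v (A ∪ S) := by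
  have hne : v (A ∪ T) ≠ v (A ∪ S) := fun he => by
    have hTS : T = S := by
      rw [← union_sdiff_cancel_left hT, ← union_sdiff_cancel_left hS]
      by_contra hST
      exact hnd (A ∪ T) (A ∪ S) (fun e => hST (by rw [e])) he
    exact h.ne (by rw [hTS])
  refine lt_of_le_of_ne (not_lt.1 fun hlt => ?_) hne
  exact lt_asymm h (hc.lt_of_union_lt_union A hT hS hlt)

end Valuations

section PoorestAgents

variable {ι : Type*} {n : ℕ} {v : Fin n → Finset ι → ℝ} {X : Fin n → Finset ι}

/-- `a` and `b` are poorest agents of their respective valuation types, and there is no third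
type. -/
def PoorestPair (v : Fin n → Finset ι → ℝ) (X : Fin n → Finset ι) (a b : Fin n) : Prop :=
  ∀ i, (v i = v a ∧ v a (X a) ≤ v i (X i)) ∨ (v i = v b ∧ v b (X b) ≤ v i (X i))

theorem PoorestPair.symm {a b : Fin n} (h : PoorestPair v X a b) : PoorestPair v X b a :=
  fun i => (h i).symm

theorem exists_poorestPair (hn : 0 < n) (X : Fin n → Finset ι) {va vb : Finset ι → ℝ}
    (hv : ∀ i, v i = va ∨ v i = vb) : ∃ a b, PoorestPair v X a b := by
  have poorest : ∀ w : Finset ι → ℝ, (∃ i, v i = w) →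
      ∃ a, v a = w ∧ ∀ i, v i = w → w (X a) ≤ w (X i) := fun w ⟨i, hi⟩ => by
    classical
    obtain ⟨a, ha, hmin⟩ := exists_min_image (univ.filter fun i => v i = w)
      (fun i => w (X i)) ⟨i, by simpa using hi⟩
    simp only [mem_filter, mem_univ, true_and] at ha hmin
    exact ⟨a, ha, hmin⟩
  by_cases hA : ∃ i, v i = va
  · obtain ⟨a, ha, hamin⟩ := poorest va hA
    by_cases hB : ∃ i, v i = vb
    · obtain ⟨b, hb, hbmin⟩ := poorest vb hB
      refine ⟨a, b, fun i => ?_⟩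
      rw [ha, hb]
      exact (hv i).imp (fun h => ⟨h, h ▸ hamin i h⟩) (fun h => ⟨h, h ▸ hbmin i h⟩)
    · refine ⟨a, a, fun i => Or.inl ?_⟩
      have h := (hv i).resolve_right fun h => hB ⟨i, h⟩
      rw [ha]
      exact ⟨h, h ▸ hamin i h⟩
  · have hB : ∀ i, v i = vb := fun i => (hv i).resolve_left fun h => hA ⟨i, h⟩
    obtain ⟨b, hb, hbmin⟩ := poorest vb ⟨⟨0, hn⟩, hB _⟩
    refine ⟨b, b, fun i => Or.inl ?_⟩
    rw [hb]
    exact ⟨hB i, hB i ▸ hbmin i (hB i)⟩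

end PoorestAgents

section Allocations

variable {ι : Type*} [DecidableEq ι] {n : ℕ} {v : Fin n → Finset ι → ℝ} {X : Fin n → Finset ι}

/-- Among the subsets of an envied set, an envied one of least size is not strongly envied. -/
theorem exists_mostEnvious {S : Finset ι} {i : Fin n} (h : EnviesSet v X i S) :
    ∃ j, MostEnvious v X j S := by
  classical
  have hne : (S.powerset.filter fun T => ∃ j, EnviesSet v X j T).Nonempty :=
    ⟨S, by simpa using ⟨i, h⟩⟩
  obtain ⟨T, hT, hmin⟩ := exists_min_image _ Finset.card hne
  simp only [mem_filter, mem_powerset] at hT hmin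
  obtain ⟨hTS, j, hj⟩ := hT
  refine ⟨j, T, hTS, hj, fun k ⟨x, hx, hk⟩ => ?_⟩
  exact (card_erase_lt_of_mem hx).not_ge
    (hmin (T.erase x) ⟨(erase_subset _ _).trans hTS, k, hk⟩)

theorem IsEFX.not_strongEnviesSet (hval : ∀ i, IsValuation (v i)) (hX : IsEFX v X)
    (i j : Fin n) : ¬ StrongEnviesSet v X i (X j) := by
  rcases eq_or_ne i j with rfl | hij
  · rintro ⟨x, _, h⟩
    exact h.not_ge ((hval i).2.2 (erase_subset _ _))
  · exact hX i j hij

theorem isEFX_of_le {Y : Fin n → Finset ι} (hle : ∀ i, v i (X i) ≤ v i (Y i))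
    (hY : ∀ i j, ¬ StrongEnviesSet v X i (Y j)) : IsEFX v Y :=
  fun i j _ ⟨x, hx, h⟩ => hY i j ⟨x, hx, (hle i).trans_lt h⟩

/-- The partial EFX allocation `X` is not Pareto dominated by another partial EFX allocation. -/
def ParetoMaximal (v : Fin n → Finset ι → ℝ) (X : Fin n → Finset ι) : Prop :=
  IsPartialAlloc X ∧ IsEFX v X ∧
    ∀ Y, IsPartialAlloc Y → IsEFX v Y → ¬ ParetoDominates v Y X

theorem exists_paretoMaximal [Fintype ι] (v : Fin n → Finset ι → ℝ) :
    ∃ X, ParetoMaximal v X := by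
  classical
  obtain ⟨X, hX, hmax⟩ := exists_max_image
    (univ.filter fun X : Fin n → Finset ι => IsPartialAlloc X ∧ IsEFX v X)
    (fun X => ∑ i, v i (X i)) ⟨fun _ => ∅, by simp [IsPartialAlloc, IsEFX, StrongEnviesSet]⟩
  simp only [mem_filter, mem_univ, true_and] at hX hmax
  refine ⟨X, hX.1, hX.2, fun Y hY hYE ⟨hle, i, hi⟩ => (hmax Y ⟨hY, hYE⟩).not_gt ?_⟩
  exact sum_lt_sum (fun j _ => hle j) ⟨i, mem_univ i, hi⟩

theorem ParetoMaximal.not_enviesSet (hX : ParetoMaximal v X) (hval : ∀ i, IsValuation (v i))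
    {i : Fin n} {T : Finset ι} (hT : ∀ k, k ≠ i → Disjoint T (X k))
    (hTn : ∀ k, ¬ StrongEnviesSet v X k T) : ¬ EnviesSet v X i T := by
  intro h
  have hle : ∀ k, v k (X k) ≤ v k (Function.update X i T k) := fun k => by
    rcases eq_or_ne k i with rfl | hk
    · simpa using le_of_lt h
    · simp [hk]
  refine hX.2.2 (Function.update X i T) (fun k l hkl => ?_) (isEFX_of_le hle fun k l => ?_)
    ⟨hle, i, by simpa [EnviesSet] using h⟩
  · rcases eq_or_ne k i with rfl | hk
    · simpa [hkl.symm] using hT l hkl.symm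
    · rcases eq_or_ne l i with rfl | hl
      · simpa [hk] using (hT k hk).symm
      · simpa [hk, hl] using hX.1 k l hkl
  · rcases eq_or_ne l i with rfl | hl
    · simpa using hTn k
    · simpa [hl] using hX.2.1.not_strongEnviesSet hval k l

theorem ParetoMaximal.not_enviesSet_pair (hX : ParetoMaximal v X)
    (hval : ∀ i, IsValuation (v i)) {i j : Fin n} (hij : i ≠ j) {S T : Finset ι}
    (hST : Disjoint S T)
    (hS : ∀ k, k ≠ i → k ≠ j → Disjoint S (X k)) (hT : ∀ k, k ≠ i → k ≠ j → Disjoint T (X k))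
    (hSn : ∀ k, ¬ StrongEnviesSet v X k S) (hTn : ∀ k, ¬ StrongEnviesSet v X k T)
    (hi : EnviesSet v X i S) : ¬ EnviesSet v X j T := by
  intro hj
  set Y := Function.update (Function.update X i S) j T with hY
  have hYi : Y i = S := by simp [hY, hij]
  have hYj : Y j = T := by simp [hY]
  have hYk : ∀ k, k ≠ i → k ≠ j → Y k = X k := fun k h1 h2 => by simp [hY, h1, h2]
  clear_value Y
  have hle : ∀ k, v k (X k) ≤ v k (Y k) := fun k => by
    rcases eq_or_ne k i with rfl | h1
    · exact hYi ▸ hi.le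
    rcases eq_or_ne k j with rfl | h2
    · exact hYj ▸ hj.le
    rw [hYk k h1 h2]
  refine hX.2.2 Y (fun k l hkl => ?_) (isEFX_of_le hle fun k l => ?_) ⟨hle, i, hYi ▸ hi⟩
  · rcases eq_or_ne k i with rfl | h1
    · rw [hYi]
      rcases eq_or_ne l j with rfl | h2
      · rwa [hYj]
      · rw [hYk l hkl.symm h2]; exact hS l hkl.symm h2
    rcases eq_or_ne k j with rfl | h2
    · rw [hYj]
      rcases eq_or_ne l i with rfl | h3
      · rw [hYi]; exact hST.symm
      · rw [hYk l h3 hkl.symm]; exact hT l h3 hkl.symm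
    rw [hYk k h1 h2]
    rcases eq_or_ne l i with rfl | h3
    · rw [hYi]; exact (hS k h1 h2).symm
    rcases eq_or_ne l j with rfl | h4
    · rw [hYj]; exact (hT k h1 h2).symm
    rw [hYk l h3 h4]; exact hX.1 k l hkl
  · rcases eq_or_ne l i with rfl | h1
    · rw [hYi]; exact hSn k
    rcases eq_or_ne l j with rfl | h2
    · rw [hYj]; exact hTn k
    rw [hYk l h1 h2]; exact hX.2.1.not_strongEnviesSet hval k l

theorem ParetoMaximal.not_champG_self (hX : ParetoMaximal v X) (hval : ∀ i, IsValuation (v i))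
    {g : ι} (hg : ∀ i, g ∉ X i) (i : Fin n) : ¬ ChampG v X g i i := by
  rintro ⟨T, hT, hi, hTn⟩
  refine hX.not_enviesSet hval (fun k hk => ?_) hTn hi
  exact Disjoint.mono_left hT (disjoint_insert_left.2 ⟨hg k, hX.1 i k hk.symm⟩)

theorem ParetoMaximal.not_enviesSet_of_champG (hX : ParetoMaximal v X)
    (hval : ∀ i, IsValuation (v i)) {g : ι} (hg : ∀ i, g ∉ X i) {a b : Fin n} (hab : a ≠ b)
    (hch : ChampG v X g a b) : ¬ EnviesSet v X b (X a) := by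
  obtain ⟨T, hT, ha, hTn⟩ := hch
  have hdisj : ∀ k, k ≠ b → Disjoint T (X k) := fun k hk =>
    Disjoint.mono_left hT (disjoint_insert_left.2 ⟨hg k, hX.1 b k hk.symm⟩)
  exact hX.not_enviesSet_pair hval hab (hdisj a hab) (fun k _ hk => hdisj k hk)
    (fun k hk _ => hX.1 a k hk.symm) hTn (fun k => hX.2.1.not_strongEnviesSet hval k a) ha

theorem PoorestPair.mostEnvious {a b : Fin n} (h : PoorestPair v X a b) {S : Finset ι}
    {i : Fin n} (hi : EnviesSet v X i S) : MostEnvious v X a S ∨ MostEnvious v X b S := by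
  obtain ⟨j, T, hTS, hj, hTn⟩ := exists_mostEnvious hi
  unfold EnviesSet at hj
  rcases h j with ⟨he, hle⟩ | ⟨he, hle⟩
  · exact Or.inl ⟨T, hTS, hle.trans_lt (he ▸ hj), hTn⟩
  · exact Or.inr ⟨T, hTS, hle.trans_lt (he ▸ hj), hTn⟩

theorem ParetoMaximal.champG (hX : ParetoMaximal v X) (hval : ∀ i, IsValuation (v i))
    (hnd : ∀ i, NonDegenerate (v i)) {g : ι} (hg : ∀ i, g ∉ X i) {a b : Fin n}
    (hp : PoorestPair v X a b) : ChampG v X g b a := by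
  refine (hp.mostEnvious (i := a) ?_).resolve_left (hX.not_champG_self hval hg a)
  refine lt_of_le_of_ne ((hval a).2.2 (subset_insert _ _)) (hnd a _ _ fun h => hg a ?_)
  rw [h]
  exact mem_insert_self _ _

/-- If `b` champions `a` with respect to `g`, then `b` wants `g` in exchange for some set `D` of
items of `a`, an exchange that `a` rejects. -/
theorem ParetoMaximal.exists_discard (hX : ParetoMaximal v X) (hval : ∀ i, IsValuation (v i))
    (hnd : ∀ i, NonDegenerate (v i)) (hc : ∀ i, Cancelable (v i)) {g : ι} (hg : ∀ i, g ∉ X i)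
    {a b : Fin n} (hch : ChampG v X g b a) (hba : ¬ EnviesSet v X b (X a)) :
    ∃ D ⊆ X a, v a {g} < v a D ∧ v b D < v b {g} ∧ v b (X b) < v b (X a \ D ∪ {g}) := by
  obtain ⟨T, hT, hb, hTn⟩ := hch
  have ha : ¬ EnviesSet v X a T := fun h => hX.not_champG_self hval hg a ⟨T, hT, h, hTn⟩
  unfold EnviesSet at ha hb hba
  have hgT : g ∈ T := by
    by_contra h
    exact hba (hb.trans_le ((hval b).2.2 ((subset_insert_iff_of_notMem h).1 hT)))
  have hTe : X a \ (X a \ T) ∪ {g} = T := by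
    ext x
    have := @hT x
    simp only [mem_insert] at this
    by_cases hx : x = g
    · simp [hx, hgT]
    · simp only [mem_union, mem_sdiff, mem_singleton]; tauto
  have hXe : X a \ (X a \ T) ∪ X a \ T = X a := sdiff_union_of_subset sdiff_subset
  have hd : Disjoint (X a \ (X a \ T)) (X a \ T) := sdiff_disjoint
  have hdg : Disjoint (X a \ (X a \ T)) {g} := by simp [hg a]
  refine ⟨X a \ T, sdiff_subset, ?_, ?_, by rwa [hTe]⟩
  · refine (hc a).lt_of_union_lt_union _ hd hdg ?_
    rw [hTe, hXe]
    exact lt_of_le_of_ne (not_lt.1 ha) (hnd a _ _ fun h => hg a (h ▸ hgT))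
  · refine (hc b).lt_of_union_lt_union _ hdg hd ?_
    rw [hTe, hXe]
    exact (not_lt.1 hba).trans_lt hb

/-- After exchanging the discard sets, `b` and only `b` is a most envious agent of the bundle
obtained from `X a`. -/
theorem PoorestPair.genChamp (hval : ∀ i, IsValuation (v i))
    (hnd : ∀ i, NonDegenerate (v i)) (hc : ∀ i, Cancelable (v i)) {g : ι} {a b : Fin n}
    (hg : g ∉ X a) (hp : PoorestPair v X a b) {D E : Finset ι} (hD : D ⊆ X a)
    (hE : Disjoint E (X a)) (haE : v a E < v a D) (hbE : v b {g} < v b E)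
    (hb : v b (X b) < v b (X a \ D ∪ {g})) : GenChamp v X b a E D := by
  have hdE : Disjoint (X a \ D) E := hE.symm.mono_left sdiff_subset
  have hb' : EnviesSet v X b (X a \ D ∪ E) :=
    hb.trans ((hc b).union_lt_union (hnd b) _ hdE (by simp [hg]) hbE)
  refine ⟨hE, hD, (hp.mostEnvious hb').resolve_left ?_⟩
  rintro ⟨T, hT, ha, -⟩
  have h := (hc a).union_lt_union (hnd a) _ sdiff_disjoint hdE haE
  rw [sdiff_union_of_subset hD] at h
  exact lt_asymm (ha.trans_le ((hval a).2.2 hT)) h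

theorem ParetoMaximal.unalloc_eq_empty [Fintype ι] (hn : 0 < n) (hX : ParetoMaximal v X)
    (hval : ∀ i, IsValuation (v i)) (hnd : ∀ i, NonDegenerate (v i))
    (hc : ∀ i, Cancelable (v i)) {va vb : Finset ι → ℝ} (hv : ∀ i, v i = va ∨ v i = vb) :
    unalloc X = ∅ := by
  by_contra hU
  obtain ⟨g, hgU⟩ := nonempty_iff_ne_empty.2 hU
  have hg : ∀ i, g ∉ X i := by simpa [unalloc] using hgU
  obtain ⟨a, b, hp⟩ := exists_poorestPair hn X hv
  have hba := hX.champG hval hnd hg hp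
  have hab := hX.champG hval hnd hg hp.symm
  have hne : a ≠ b := fun h => hX.not_champG_self hval hg a (by rwa [← h] at hab)
  obtain ⟨D, hD, haD, hbD, hbT⟩ := hX.exists_discard hval hnd hc hg hba
    (hX.not_enviesSet_of_champG hval hg hne hab)
  obtain ⟨E, hE, hbE, haE, haT⟩ := hX.exists_discard hval hnd hc hg hab
    (hX.not_enviesSet_of_champG hval hg hne.symm hba)
  have hd := hX.1 a b hne
  obtain ⟨-, -, T₁, hT₁, hb, hn₁⟩ := hp.genChamp hval hnd hc (hg a) hD
    (hd.symm.mono_left hE) (haE.trans haD) hbE hbT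
  obtain ⟨-, -, T₂, hT₂, ha, hn₂⟩ := hp.symm.genChamp hval hnd hc (hg b) hE
    (hd.mono_left hD) (hbD.trans hbE) haD haT
  have hdisj : ∀ k, k ≠ a → k ≠ b → Disjoint (X a ∪ X b) (X k) := fun k h1 h2 =>
    disjoint_union_left.2 ⟨hX.1 a k h1.symm, hX.1 b k h2.symm⟩
  refine hX.not_enviesSet_pair hval hne ?_ (fun k h1 h2 => (hdisj k h1 h2).mono_left ?_)
    (fun k h1 h2 => (hdisj k h1 h2).mono_left ?_) hn₂ hn₁ ha hb
  · refine Disjoint.mono hT₂ hT₁ ?_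
    rw [disjoint_union_left, disjoint_union_right, disjoint_union_right]
    exact ⟨⟨hd.symm.mono sdiff_subset sdiff_subset, sdiff_disjoint⟩,
      disjoint_sdiff, hd.mono hD hE⟩
  · exact hT₂.trans (union_subset (sdiff_subset.trans subset_union_right)
      (hD.trans subset_union_left))
  · exact hT₁.trans (union_subset (sdiff_subset.trans subset_union_left)
      (hE.trans subset_union_right))

end Allocations

/-- If `va` and `vb` are two nice cancelable valuations and each of
the `n` agents has valuation `va` or `vb`, then a complete EFX allocation exists. -/
theorem efx_two_valuation_types_complete
    {ι : Type*} [DecidableEq ι] [Fintype ι] {n : ℕ} (hn : 0 < n)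
    (va vb : Finset ι → ℝ)
    (hva : IsValuation va) (hvb : IsValuation vb)
    (hna : NiceCancelable va) (hnb : NiceCancelable vb)
    (v : Fin n → Finset ι → ℝ) (hv : ∀ i, v i = va ∨ v i = vb) :
    ∃ X : Fin n → Finset ι, IsPartialAlloc X ∧ IsEFX v X ∧ unalloc X = ∅ := by
  obtain ⟨-, wa, hwa, hnwa, hcwa, hra⟩ := hna
  obtain ⟨-, wb, hwb, hnwb, hcwb, hrb⟩ := hnb
  have hw : ∀ i, ∃ w, (w = wa ∨ w = wb) ∧ Respects w (v i) := fun i =>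
    (hv i).elim (fun h => ⟨wa, Or.inl rfl, h ▸ hra⟩) (fun h => ⟨wb, Or.inr rfl, h ▸ hrb⟩)
  choose w hw hr using hw
  obtain ⟨X, hX⟩ := exists_paretoMaximal w
  refine ⟨X, hX.1, fun i j hij ⟨x, hx, h⟩ => hX.2.1 i j hij ⟨x, hx, hr i _ _ h⟩, ?_⟩
  exact hX.unalloc_eq_empty hn
    (fun i => (hw i).elim (fun h => h ▸ hwa) (fun h => h ▸ hwb))
    (fun i => (hw i).elim (fun h => h ▸ hnwa) (fun h => h ▸ hnwb))
    (fun i => (hw i).elim (fun h => h ▸ hcwa) (fun h => h ▸ hcwb)) hw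

end FairDivision
end

section
/- Let M be a finite set of items, let w : M → ℝ≥0, let B > 0, and define the budget-additive valuation v(S) = min(Σ_{g∈S} w(g), B) for S ⊆ M. Then v is cancelable, and v is nice: there exists a non-degenerate cancelable valuation v' that respects v. -/
namespace FairDivision

open Finset

theorem isValuation_sum {ι : Type*} {u : ι → ℝ} (hu : ∀ g, 0 ≤ u g) :
    IsValuation (fun S : Finset ι => ∑ g ∈ S, u g) :=
  ⟨sum_empty, fun _ => sum_nonneg fun g _ => hu g,
    fun _ _ h => sum_le_sum_of_subset_of_nonneg h fun g _ _ => hu g⟩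

theorem cancelable_sum {ι : Type*} [DecidableEq ι] (u : ι → ℝ) :
    Cancelable (fun S : Finset ι => ∑ g ∈ S, u g) := by
  intro S T g hS hT h
  simpa [sum_insert hS, sum_insert hT] using h

theorem cancelable_min_sum {ι : Type*} [DecidableEq ι] {w : ι → ℝ} (hw : ∀ g, 0 ≤ w g)
    (B : ℝ) : Cancelable (fun S : Finset ι => min (∑ g ∈ S, w g) B) := by
  intro S T g hS hT h
  simp only [sum_insert hS, sum_insert hT, gt_iff_lt, min_lt_iff, lt_min_iff] at h ⊢
  have := hw g
  obtain ⟨hTS | hBS, hTB | hBB⟩ := h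
  · exact ⟨.inl (by linarith), .inl (by linarith)⟩
  · exact absurd hBB (lt_irrefl B)
  · exact ⟨.inl (by linarith), .inl (by linarith)⟩
  · exact absurd hBB (lt_irrefl B)

/-- Item weights given by distinct powers of two separate all bundles. -/
theorem exists_nonneg_sum_injective (ι : Type*) [Finite ι] :
    ∃ p : ι → ℝ, (∀ g, 0 ≤ p g) ∧ Function.Injective fun S : Finset ι => ∑ g ∈ S, p g := by
  obtain ⟨n, ⟨e⟩⟩ := Finite.exists_equiv_fin ι
  let f : ι ↪ ℕ := e.toEmbedding.trans Fin.valEmbedding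
  refine ⟨fun g => 2 ^ f g, fun g => by positivity, fun S T h => ?_⟩
  dsimp only at h
  have h_nat : ∑ g ∈ S, 2 ^ f g = ∑ g ∈ T, 2 ^ f g := by exact_mod_cast h
  apply map_injective f
  apply geomSum_injective le_rfl
  simpa only [sum_map] using h_nat

/-- A sufficiently small perturbation preserves every strict inequality between bundles. -/
theorem exists_pos_perturbation {ι : Type*} [Finite ι] (w p : ι → ℝ) :
    ∃ ε > 0, ∀ S T : Finset ι, ∑ g ∈ T, w g < ∑ g ∈ S, w g →
      ∑ g ∈ T, (w g + ε * p g) < ∑ g ∈ S, (w g + ε * p g) := by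
  have h : ∀ᶠ ε : ℝ in nhdsWithin 0 (Set.Ioi 0), ∀ S T : Finset ι,
      ∑ g ∈ T, w g < ∑ g ∈ S, w g →
      ∑ g ∈ T, (w g + ε * p g) < ∑ g ∈ S, (w g + ε * p g) := by
    simp only [Filter.eventually_all]
    intro S T hlt
    have hcont (U : Finset ι) : Continuous fun ε : ℝ => ∑ g ∈ U, (w g + ε * p g) := by
      fun_prop
    exact ((hcont T).continuousAt.eventually_lt (hcont S).continuousAt
      (by simpa using hlt)).filter_mono nhdsWithin_le_nhds
  exact (eventually_mem_nhdsWithin.and h).exists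

/-- A budget-additive valuation `v S = min (∑ g ∈ S, w g) B`
(with `w ≥ 0` and `B > 0`) over a finite item set is cancelable and nice:
some non-degenerate cancelable valuation respects it. -/
theorem budgetAdditive_niceCancelable
    {ι : Type*} [DecidableEq ι] [Fintype ι]
    (w : ι → ℝ) (hw : ∀ g, 0 ≤ w g) (B : ℝ) (hB : 0 < B)
    (v : Finset ι → ℝ) (hv : ∀ S : Finset ι, v S = min (∑ g ∈ S, w g) B) :
    NiceCancelable v := by
  obtain rfl : v = fun S => min (∑ g ∈ S, w g) B := funext hv
  obtain ⟨p, hp, hinj⟩ := exists_nonneg_sum_injective ι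
  obtain ⟨ε, hε, hlt⟩ := exists_pos_perturbation w p
  refine ⟨cancelable_min_sum hw B, fun S => ∑ g ∈ S, (w g + ε * p g),
    isValuation_sum fun g => add_nonneg (hw g) (mul_nonneg hε.le (hp g)), ?_,
    cancelable_sum _, fun S T h => hlt S T (lt_of_not_ge fun hle => ?_)⟩
  · intro S T hne heq
    have hw_eq : ∑ g ∈ S, w g = ∑ g ∈ T, w g :=
      le_antisymm (not_lt.1 fun h => (hlt S T h).ne' heq)
        (not_lt.1 fun h => (hlt T S h).ne heq)
    simp only [sum_add_distrib, ← mul_sum, hw_eq] at heq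
    exact hne (hinj (mul_left_cancel₀ hε.ne' (add_left_cancel heq)))
  · exact h.not_ge (min_le_min_right B hle)

end FairDivision
end

section
/- Let M be a finite set of items, let w : M → ℝ≥0, and define the unit-demand valuation v(S) = max_{g∈S} w(g) for nonempty S ⊆ M and v(∅) = 0. Then v is cancelable, and v is nice: there exists a non-degenerate cancelable valuation v' that respects v. -/
namespace FairDivision

open Finset

/-- The additive valuation in which item `g` is worth `2 ^ e g`. -/
def binaryValuation {ι : Type*} (e : ι → ℕ) (S : Finset ι) : ℝ :=
  ∑ g ∈ S, (2 : ℝ) ^ e g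

theorem binaryValuation_eq_natCast {ι : Type*} (e : ι ↪ ℕ) (S : Finset ι) :
    binaryValuation e S = ((∑ k ∈ S.map e, 2 ^ k : ℕ) : ℝ) := by
  simp [binaryValuation]

theorem isValuation_binaryValuation {ι : Type*} (e : ι → ℕ) :
    IsValuation (binaryValuation e) :=
  ⟨Finset.sum_empty, fun _ => Finset.sum_nonneg fun _ _ => by positivity,
    fun _ _ h => Finset.sum_le_sum_of_subset_of_nonneg h fun _ _ _ => by positivity⟩

theorem cancelable_binaryValuation {ι : Type*} [DecidableEq ι] (e : ι → ℕ) :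
    Cancelable (binaryValuation e) := by
  intro S T g hS hT h
  simpa [binaryValuation, Finset.sum_insert, hS, hT] using h

theorem nonDegenerate_binaryValuation {ι : Type*} (e : ι ↪ ℕ) :
    NonDegenerate (binaryValuation e) := by
  intro S T hST h
  rw [binaryValuation_eq_natCast, binaryValuation_eq_natCast, Nat.cast_inj] at h
  exact hST (Finset.map_injective e (Finset.geomSum_injective le_rfl h))

theorem binaryValuation_lt_of_forall_lt {ι : Type*} (e : ι ↪ ℕ) {S T : Finset ι} {g : ι}
    (hg : g ∈ S) (hT : ∀ t ∈ T, e t < e g) : binaryValuation e T < binaryValuation e S := by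
  have h : ∑ k ∈ T.map e, 2 ^ k < 2 ^ e g := Nat.geomSum_lt le_rfl (by simpa using hT)
  calc binaryValuation e T < (2 : ℝ) ^ e g := by
        rw [binaryValuation_eq_natCast]; exact_mod_cast h
    _ ≤ binaryValuation e S :=
        Finset.single_le_sum (f := fun g => (2 : ℝ) ^ e g) (fun _ _ => by positivity) hg

/-- The items of a finite set can be ranked, without ties, compatibly with their weights. -/
theorem exists_embedding_nat_of_weight {ι : Type*} [Fintype ι] (w : ι → ℝ) :
    ∃ e : ι ↪ ℕ, ∀ g h, w g < w h → e g < e h := by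
  let φ := Fintype.equivFin ι
  let σ := Tuple.sort (w ∘ φ.symm)
  refine ⟨(φ.trans σ.symm).toEmbedding.trans Fin.valEmbedding, fun g h hgh => ?_⟩
  by_contra hlt
  have hle : σ.symm (φ h) ≤ σ.symm (φ g) := not_lt.mp hlt
  have := Tuple.monotone_sort (w ∘ φ.symm) hle
  simp only [Function.comp_apply] at this
  change w (φ.symm (σ (σ.symm (φ h)))) ≤ w (φ.symm (σ (σ.symm (φ g)))) at this
  simp only [Equiv.apply_symm_apply, Equiv.symm_apply_apply] at this
  exact this.not_gt hgh

/-- A unit-demand valuation `v S = max_{g ∈ S} w g` (with `w ≥ 0`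
and `v ∅ = 0`) over a finite item set is cancelable and nice: some
non-degenerate cancelable valuation respects it. -/
theorem unitDemand_niceCancelable
    {ι : Type*} [DecidableEq ι] [Fintype ι]
    (w : ι → ℝ) (hw : ∀ g, 0 ≤ w g)
    (v : Finset ι → ℝ) (hv0 : v ∅ = 0)
    (hv : ∀ (S : Finset ι) (hS : S.Nonempty), v S = S.sup' hS w) :
    NiceCancelable v := by
  have hle : ∀ (S : Finset ι), ∀ g ∈ S, w g ≤ v S := fun S g hg => by
    rw [hv S ⟨g, hg⟩]; exact Finset.le_sup' w hg
  have hnonneg : ∀ S, 0 ≤ v S := fun S => by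
    obtain rfl | ⟨g, hg⟩ := S.eq_empty_or_nonempty
    · exact hv0.ge
    · exact (hw g).trans (hle S g hg)
  have hinsert : ∀ S g, v (insert g S) = max (w g) (v S) := fun S g => by
    obtain rfl | hS := S.eq_empty_or_nonempty
    · rw [hv _ (Finset.insert_nonempty g ∅), hv0, max_eq_left (hw g)]
      simp
    · rw [hv _ (Finset.insert_nonempty g S), hv S hS, Finset.sup'_insert]
  refine ⟨fun S T g _ _ h => ?_, ?_⟩
  · rw [hinsert, hinsert] at h
    by_contra hST
    exact h.not_ge (max_le_max_left _ (not_lt.mp hST))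
  · obtain ⟨e, he⟩ := exists_embedding_nat_of_weight w
    refine ⟨binaryValuation e, isValuation_binaryValuation e, nonDegenerate_binaryValuation e,
      cancelable_binaryValuation e, fun S T h => ?_⟩
    have hS : S.Nonempty := by
      rw [Finset.nonempty_iff_ne_empty]
      rintro rfl
      exact (hnonneg T).not_gt (hv0 ▸ h)
    obtain ⟨g, hg, hgv⟩ := Finset.exists_mem_eq_sup' hS w
    refine binaryValuation_lt_of_forall_lt e hg fun t ht => he t g ?_
    rw [← hgv, ← hv S hS]
    exact (hle T t ht).trans_lt h

end FairDivision
end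

section
/- There exist a finite set M with |M| = 6 and a monotone valuation v : 2^M → ℝ≥0 with v(∅) = 0 that is submodular and cancelable but not nice; that is, no non-degenerate cancelable valuation respects v. -/
namespace FairDivision

open Finset

/-- `v` is submodular (decreasing marginals). -/
def Submodular {ι : Type*} [DecidableEq ι] (v : Finset ι → ℝ) : Prop :=
  ∀ S T : Finset ι, S ⊆ T → ∀ g : ι, g ∉ T →
    v (insert g T) - v T ≤ v (insert g S) - v S

/-- In a non-degenerate cancelable valuation, adding an item preserves strict preference. -/
theorem Cancelable.insert_lt_insert {ι : Type*} [DecidableEq ι] {v : Finset ι → ℝ}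
    (hc : Cancelable v) (hn : NonDegenerate v) {S T : Finset ι} {g : ι}
    (hS : g ∉ S) (hT : g ∉ T) (h : v S < v T) : v (insert g S) < v (insert g T) := by
  have hne : insert g S ≠ insert g T := fun he => by
    rw [← erase_insert hS, ← erase_insert hT, he] at h
    exact lt_irrefl _ h
  refine lt_of_le_of_ne (le_of_not_gt fun hgt => ?_) (hn _ _ hne)
  exact lt_asymm h (hc S T g hS hT hgt)

/-- A non-degenerate cancelable valuation cannot have three strict preferences between pairs
which add up to zero. -/
theorem Cancelable.no_pair_cycle {ι : Type*} [DecidableEq ι] {v : Finset ι → ℝ}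
    (hc : Cancelable v) (hn : NonDegenerate v) {a b p q r s : ι}
    (hd : [a, b, p, q, r, s].Nodup) (h₁ : v {b, q} < v {a, p}) (h₂ : v {a, s} < v {b, r}) :
    ¬ v {p, r} < v {q, s} := by
  intro h₃
  simp only [List.nodup_cons, List.mem_cons, List.not_mem_nil, or_false, not_or] at hd
  have k₁ := hc.insert_lt_insert hn (g := r) (by grind) (by grind) h₁
  have k₂ := hc.insert_lt_insert hn (g := q) (by grind) (by grind) h₂
  have k₃ := hc.insert_lt_insert hn (g := a) (by grind) (by grind) h₃
  have e₁ : insert r {b, q} = (insert q {b, r} : Finset ι) := by grind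
  have e₂ : insert r {a, p} = (insert a {p, r} : Finset ι) := by grind
  have e₃ : insert a {q, s} = (insert q {a, s} : Finset ι) := by grind
  rw [e₁, e₂] at k₁
  rw [e₃] at k₃
  exact lt_irrefl _ (k₁.trans (k₃.trans k₂))

/-- A valuation on six items that is constant on bundles of size at least three and almost
additive on pairs, with ties between complementary pairs broken in a cyclic way. -/
def cyclicPairValue (S : Finset (Fin 6)) : ℕ :=
  if #S = 0 then 0
  else if #S = 1 then 100 + ∑ i ∈ S, i.val
  else if #S = 2 then
    150 + 2 * ∑ i ∈ S, i.val + if S = {1, 2} ∨ S = {0, 5} ∨ S = {3, 4} then 1 else 0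
  else 180

theorem cyclicPairValue_empty : cyclicPairValue ∅ = 0 := by decide

theorem cyclicPairValue_of_three_le_card {S : Finset (Fin 6)} (h : 3 ≤ #S) :
    cyclicPairValue S = 180 := by
  unfold cyclicPairValue
  split_ifs <;> omega

theorem cyclicPairValue_mem_Icc_of_card_eq_one {S : Finset (Fin 6)} (h : #S = 1) :
    cyclicPairValue S ∈ Set.Icc 100 105 := by
  obtain ⟨x, rfl⟩ := card_eq_one.mp h
  revert x
  simp only [Set.mem_Icc]
  decide

theorem cyclicPairValue_mem_Icc_of_card_eq_two {S : Finset (Fin 6)} (h : #S = 2) :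
    cyclicPairValue S ∈ Set.Icc 150 169 := by
  obtain ⟨x, y, hxy, rfl⟩ := card_eq_two.mp h
  revert x y
  simp only [Set.mem_Icc]
  decide

theorem cyclicPairValue_bounds (S : Finset (Fin 6)) :
    (S = ∅ ∧ #S = 0 ∧ cyclicPairValue S = 0) ∨
    (#S = 1 ∧ 100 ≤ cyclicPairValue S ∧ cyclicPairValue S ≤ 105) ∨
    (#S = 2 ∧ 150 ≤ cyclicPairValue S ∧ cyclicPairValue S ≤ 169) ∨
    (3 ≤ #S ∧ cyclicPairValue S = 180) := by
  obtain h | h | h | h : #S = 0 ∨ #S = 1 ∨ #S = 2 ∨ 3 ≤ #S := by omega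
  · obtain rfl := card_eq_zero.mp h
    exact Or.inl ⟨rfl, h, cyclicPairValue_empty⟩
  · exact Or.inr (Or.inl ⟨h, cyclicPairValue_mem_Icc_of_card_eq_one h⟩)
  · exact Or.inr (Or.inr (Or.inl ⟨h, cyclicPairValue_mem_Icc_of_card_eq_two h⟩))
  · exact Or.inr (Or.inr (Or.inr ⟨h, cyclicPairValue_of_three_le_card h⟩))

theorem cyclicPairValue_lt_of_card_lt {S T : Finset (Fin 6)} (h : #S < #T) (hS : #S < 3) :
    cyclicPairValue S < cyclicPairValue T := by
  have := cyclicPairValue_bounds S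
  have := cyclicPairValue_bounds T
  omega

theorem cyclicPairValue_mono : Monotone cyclicPairValue := by
  intro S T h
  rcases (card_le_card h).eq_or_lt with hc | hc
  · rw [eq_of_subset_of_card_le h hc.ge]
  · have := cyclicPairValue_bounds S
    have := cyclicPairValue_bounds T
    omega

theorem cyclicPairValue_submodular : Submodular fun S => (cyclicPairValue S : ℝ) := by
  intro S T h g hg
  have key : cyclicPairValue (insert g T) + cyclicPairValue S ≤
      cyclicPairValue (insert g S) + cyclicPairValue T := by
    rcases (card_le_card h).eq_or_lt with hc | hc
    · rw [eq_of_subset_of_card_le h hc.ge, add_comm]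
    · have hcS := card_insert_of_notMem fun hS => hg (h hS)
      have hcT := card_insert_of_notMem hg
      have := cyclicPairValue_bounds S
      have := cyclicPairValue_bounds T
      have := cyclicPairValue_bounds (insert g S)
      have := cyclicPairValue_bounds (insert g T)
      have := cyclicPairValue_mono (subset_insert g S)
      omega
  have := Nat.cast_le (α := ℝ).mpr key
  push_cast at this
  linarith

theorem cyclicPairValue_singleton_lt {s t g : Fin 6} (hs : g ≠ s) (ht : g ≠ t)
    (h : cyclicPairValue {g, t} < cyclicPairValue {g, s}) :
    cyclicPairValue {t} < cyclicPairValue {s} := by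
  revert s t g
  decide

theorem cyclicPairValue_cancelable : Cancelable fun S => (cyclicPairValue S : ℝ) := by
  intro S T g hS hT h
  simp only [gt_iff_lt, Nat.cast_lt] at h ⊢
  have hcS := card_insert_of_notMem hS
  have hcT := card_insert_of_notMem hT
  have bS := cyclicPairValue_bounds (insert g S)
  have bT := cyclicPairValue_bounds (insert g T)
  have hT2 : #T < 2 := by omega
  rcases lt_trichotomy (#S) (#T) with hc | hc | hc
  · exact absurd h (cyclicPairValue_lt_of_card_lt (by omega) (by omega)).not_gt
  · obtain h0 | h1 : #T = 0 ∨ #T = 1 := by omega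
    · rw [card_eq_zero.mp h0, card_eq_zero.mp (hc.trans h0)] at h
      exact absurd h (lt_irrefl _)
    · obtain ⟨t, rfl⟩ := card_eq_one.mp h1
      obtain ⟨s, rfl⟩ := card_eq_one.mp (hc.trans h1)
      exact cyclicPairValue_singleton_lt (by simpa using hS) (by simpa using hT) h
  · exact cyclicPairValue_lt_of_card_lt hc (by omega)

/-- There exist a finite set `M` with `|M| = 6` and a (monotone,
normalized) valuation on `M` that is submodular and cancelable but not nice:
no non-degenerate cancelable valuation respects it. -/
theorem exists_submodular_cancelable_not_nice :
    ∃ (M : Type) (instD : DecidableEq M) (instF : Fintype M),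
      @Fintype.card M instF = 6 ∧
      ∃ v : Finset M → ℝ, IsValuation v ∧ @Submodular M instD v ∧
        @Cancelable M instD v ∧
        ¬ ∃ v' : Finset M → ℝ, IsValuation v' ∧ NonDegenerate v' ∧
            @Cancelable M instD v' ∧ Respects v' v := by
  refine ⟨Fin 6, inferInstance, inferInstance, Fintype.card_fin 6,
    fun S => (cyclicPairValue S : ℝ),
    ⟨by simp [cyclicPairValue_empty], fun S => Nat.cast_nonneg _,
      fun S T h => Nat.cast_le.mpr (cyclicPairValue_mono h)⟩,
    cyclicPairValue_submodular, cyclicPairValue_cancelable, ?_⟩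
  rintro ⟨v', -, hn, hc, hr⟩
  have lift (S T : Finset (Fin 6)) (h : cyclicPairValue S < cyclicPairValue T) : v' S < v' T :=
    hr T S (Nat.cast_lt.mpr h)
  exact hc.no_pair_cycle hn (a := 1) (b := 0) (p := 2) (q := 3) (r := 5) (s := 4) (by decide)
    (lift _ _ (by decide)) (lift _ _ (by decide)) (lift _ _ (by decide))

end FairDivision
end

section
/- Fix an arbitrary ordering of the agents. (i) If in a partial EFX allocation X some agent envies the set U of unallocated items, then there exists a partial EFX allocation that Pareto dominates X. (ii) If for every partial EFX allocation X with at least k unallocated items (for some fixed k ≥ 1) there exists a partial EFX allocation that dominates X, then there exists a partial EFX allocation with at most k−1 unallocated items in which, moreover, no agent envies the set of unallocated items. -/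
namespace FairDivision

open Finset

/-- Giving an agent a minimum-size envied set of unallocated items keeps the allocation EFX
and Pareto dominates the original one. -/
theorem exists_paretoDominates_of_enviesSet_unalloc
    {ι : Type*} [DecidableEq ι] [Fintype ι] {n : ℕ} (v : Fin n → Finset ι → ℝ)
    (X : Fin n → Finset ι) (hX : IsPartialAlloc X) (hE : IsEFX v X)
    (henvy : ∃ i : Fin n, EnviesSet v X i (unalloc X)) :
    ∃ Y : Fin n → Finset ι, IsPartialAlloc Y ∧ IsEFX v Y ∧ ParetoDominates v Y X := by
  classical
  obtain ⟨i₀, hi₀⟩ := henvy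
  obtain ⟨T, hT, hmin⟩ := Finset.exists_min_image
    ((unalloc X).powerset.filter fun T => ∃ i, EnviesSet v X i T) Finset.card
    ⟨unalloc X, by simpa using ⟨i₀, hi₀⟩⟩
  simp only [Finset.mem_filter, Finset.mem_powerset] at hT hmin
  obtain ⟨hTU, i, hi⟩ := hT
  have hstrong : ∀ j, ¬ StrongEnviesSet v X j T := by
    rintro j ⟨h, hh, hlt⟩
    have := hmin (T.erase h) ⟨(Finset.erase_subset h T).trans hTU, j, hlt⟩
    have := Finset.card_erase_lt_of_mem hh
    omega
  have hdisj : ∀ j, Disjoint T (X j) := fun j =>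
    Finset.disjoint_of_subset_left hTU <| Finset.disjoint_of_subset_right
      (Finset.subset_biUnion_of_mem X (Finset.mem_univ j)) Finset.sdiff_disjoint
  have hle : ∀ j, v j (X j) ≤ v j (Function.update X i T j) := by
    intro j
    rcases eq_or_ne j i with rfl | hj
    · rw [Function.update_self]
      exact hi.le
    · rw [Function.update_of_ne hj]
  refine ⟨Function.update X i T, ?_, ?_, hle, i, ?_⟩
  · intro p q hpq
    rcases eq_or_ne p i with rfl | hp
    · rw [Function.update_self, Function.update_of_ne hpq.symm]
      exact hdisj q
    · rw [Function.update_of_ne hp]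
      rcases eq_or_ne q i with rfl | hq
      · rw [Function.update_self]
        exact (hdisj p).symm
      · rw [Function.update_of_ne hq]
        exact hX p q hpq
  · rintro p q hpq ⟨h, hh, hlt⟩
    have hlt' := (hle p).trans_lt hlt
    rcases eq_or_ne q i with rfl | hq
    · rw [Function.update_self] at hh hlt'
      exact hstrong p ⟨h, hh, hlt'⟩
    · rw [Function.update_of_ne hq] at hh hlt'
      exact hE p q hpq ⟨h, hh, hlt'⟩
  · rw [Function.update_self]
    exact hi

/-- The vector of the agents' values, in the order `a`, compared lexicographically. -/
def valueProfile {ι : Type*} {n : ℕ} (v : Fin n → Finset ι → ℝ) (a : Fin n → Fin n)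
    (X : Fin n → Finset ι) : Lex (Fin n → ℝ) :=
  toLex fun j => v (a j) (X (a j))

theorem Dominates.valueProfile_lt {ι : Type*} {n : ℕ} {v : Fin n → Finset ι → ℝ}
    {a : Fin n → Fin n} {Y X : Fin n → Finset ι} (h : Dominates v a Y X) :
    valueProfile v a X < valueProfile v a Y := by
  obtain ⟨k, heq, hlt⟩ := h
  exact ⟨k, fun j hj => (heq j hj).symm, hlt⟩

theorem ParetoDominates.valueProfile_lt {ι : Type*} {n : ℕ} {v : Fin n → Finset ι → ℝ}
    {a : Fin n → Fin n} (ha : Function.Surjective a) {Y X : Fin n → Finset ι}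
    (h : ParetoDominates v Y X) : valueProfile v a X < valueProfile v a Y := by
  obtain ⟨hle, i, hlt⟩ := h
  obtain ⟨k, rfl⟩ := ha i
  exact Pi.toLex_strictMono (Pi.lt_def.2 ⟨fun j => hle (a j), k, hlt⟩)

/-- (i) If in a partial EFX allocation `X` some agent envies the set
of unallocated items, then some partial EFX allocation Pareto dominates `X`.
(ii) If for every partial EFX allocation with at least `k ≥ 1` unallocated items
there is a dominating partial EFX allocation, then there exists a partial EFX
allocation with at most `k - 1` unallocated items in which no agent envies the
set of unallocated items. -/
theorem dominate_implies_progress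
    {ι : Type*} [DecidableEq ι] [Fintype ι] {n : ℕ}
    (v : Fin n → Finset ι → ℝ) (hval : ∀ i, IsValuation (v i))
    (a : Fin n → Fin n) (ha : Function.Bijective a) :
    (∀ X : Fin n → Finset ι, IsPartialAlloc X → IsEFX v X →
      (∃ i : Fin n, EnviesSet v X i (unalloc X)) →
      ∃ Y : Fin n → Finset ι, IsPartialAlloc Y ∧ IsEFX v Y ∧ ParetoDominates v Y X) ∧
    (∀ k : ℕ, 1 ≤ k →
      (∀ X : Fin n → Finset ι, IsPartialAlloc X → IsEFX v X →
        k ≤ (unalloc X).card →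
        ∃ Y : Fin n → Finset ι, IsPartialAlloc Y ∧ IsEFX v Y ∧ Dominates v a Y X) →
      ∃ X : Fin n → Finset ι, IsPartialAlloc X ∧ IsEFX v X ∧
        (unalloc X).card ≤ k - 1 ∧ ∀ i : Fin n, ¬ EnviesSet v X i (unalloc X)) := by
  classical
  refine ⟨exists_paretoDominates_of_enviesSet_unalloc v, fun k hk hdom => ?_⟩
  obtain ⟨X, hX, hmax⟩ := Finset.exists_max_image
    (Finset.univ.filter fun X : Fin n → Finset ι => IsPartialAlloc X ∧ IsEFX v X)
    (valueProfile v a)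
    ⟨fun _ => ∅, by simp [IsPartialAlloc, IsEFX, StrongEnviesSet]⟩
  simp only [Finset.mem_filter, Finset.mem_univ, true_and] at hX hmax
  refine ⟨X, hX.1, hX.2, ?_, fun i hi => ?_⟩
  · by_contra hcard
    obtain ⟨Y, hY, hYE, hYX⟩ := hdom X hX.1 hX.2 (by omega)
    exact (hmax Y ⟨hY, hYE⟩).not_gt hYX.valueProfile_lt
  · obtain ⟨Y, hY, hYE, hYX⟩ :=
      exists_paretoDominates_of_enviesSet_unalloc v X hX.1 hX.2 ⟨i, hi⟩
    exact (hmax Y ⟨hY, hYE⟩).not_gt (hYX.valueProfile_lt ha.surjective)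

end FairDivision
end

section
/- Let X be a partial EFX allocation. If the champion graph M_X contains a Pareto improvable cycle C, then there exists a partial EFX allocation Y that Pareto dominates X; moreover, v_i(Y_i) > v_i(X_i) for every agent i on C. -/
namespace FairDivision

open Finset

/-- A Pareto-improvable (PI) cycle in the champion graph of `X`: a cycle of
distinct agents `a t` whose `t`-th edge is a generalized champion edge
`a t ▷_{H t | S t} a (t+1)` with a chosen discard set `D t` (so `a t` envies
`((X (a (t+1)) \ S t) ∪ H t) \ D t` and no agent strongly envies that set),
such that the sets `H t` are pairwise disjoint and each `H t` either consists of
unallocated items or is released by one of the edges of the cycle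
(i.e. `H t ⊆ S s ∪ D s` for some edge `s`). -/
structure PICycle {ι : Type*} [DecidableEq ι] [Fintype ι] {n : ℕ}
    (v : Fin n → Finset ι → ℝ) (X : Fin n → Finset ι) where
  k : ℕ
  kpos : 0 < k
  a : ZMod k → Fin n
  inj : Function.Injective a
  H : ZMod k → Finset ι
  S : ZMod k → Finset ι
  D : ZMod k → Finset ι
  H_disj : ∀ t : ZMod k, Disjoint (H t) (X (a (t + 1)))
  S_sub : ∀ t : ZMod k, S t ⊆ X (a (t + 1))
  D_sub : ∀ t : ZMod k, D t ⊆ (X (a (t + 1)) \ S t) ∪ H t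
  envies : ∀ t : ZMod k, EnviesSet v X (a t) (((X (a (t + 1)) \ S t) ∪ H t) \ D t)
  no_strong : ∀ (t : ZMod k) (j : Fin n),
    ¬ StrongEnviesSet v X j (((X (a (t + 1)) \ S t) ∪ H t) \ D t)
  H_pairwise : ∀ t s : ZMod k, t ≠ s → Disjoint (H t) (H s)
  H_avail : ∀ t : ZMod k, H t ⊆ unalloc X ∨ ∃ s : ZMod k, H t ⊆ S s ∪ D s

namespace PICycle

variable {ι : Type*} [DecidableEq ι] [Fintype ι] {n : ℕ}
  {v : Fin n → Finset ι → ℝ} {X : Fin n → Finset ι}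

/-- The set that the `t`-th agent of the cycle envies along its edge. -/
def target (C : PICycle v X) (t : ZMod C.k) : Finset ι :=
  ((X (C.a (t + 1)) \ C.S t) ∪ C.H t) \ C.D t

open Classical in
/-- The allocation in which every agent of the cycle receives the set it envies along its edge,
and every other agent keeps its bundle. -/
noncomputable def reallocate (C : PICycle v X) (i : Fin n) : Finset ι :=
  if h : ∃ t, C.a t = i then C.target h.choose else X i

theorem reallocate_apply (C : PICycle v X) (t : ZMod C.k) :
    C.reallocate (C.a t) = C.target t := by
  have h : ∃ s, C.a s = C.a t := ⟨t, rfl⟩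
  rw [reallocate, dif_pos h, C.inj h.choose_spec]

theorem reallocate_of_notMem (C : PICycle v X) {i : Fin n} (h : ¬∃ t, C.a t = i) :
    C.reallocate i = X i :=
  dif_neg h

/-- An allocated item of `H t` that is not discarded by the `t`-th edge is released from its
owner's bundle by the edge entering that owner. -/
theorem exists_released (C : PICycle v X) (hX : IsPartialAlloc X) {t : ZMod C.k} {x : ι}
    {j : Fin n} (hH : x ∈ C.H t) (hD : x ∉ C.D t) (hj : x ∈ X j) :
    ∃ r, j = C.a (r + 1) ∧ x ∈ C.S r ∪ C.D r := by
  rcases C.H_avail t with hU | ⟨r, hr⟩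
  · have hx := hU hH
    simp only [unalloc, mem_sdiff, mem_univ, mem_biUnion, true_and, not_exists] at hx
    exact absurd hj (hx j)
  refine ⟨r, ?_, hr hH⟩
  have hxr : x ∈ X (C.a (r + 1)) := by
    rcases mem_union.mp (hr hH) with hS | hDr
    · exact C.S_sub r hS
    · rcases mem_union.mp (C.D_sub r hDr) with h | h
      · exact (mem_sdiff.mp h).1
      · have hrt : t ≠ r := fun e => hD (e ▸ hDr)
        exact absurd h (disjoint_left.mp (C.H_pairwise t r hrt) hH)
  by_contra hne
  exact disjoint_left.mp (hX _ _ hne) hj hxr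

theorem disjoint_target_bundle (C : PICycle v X) (hX : IsPartialAlloc X) (t : ZMod C.k)
    {j : Fin n} (hj : ¬∃ s, C.a s = j) : Disjoint (C.target t) (X j) := by
  refine disjoint_left.mpr fun x hx hxj => ?_
  obtain ⟨hx, hD⟩ := mem_sdiff.mp hx
  rcases mem_union.mp hx with h | h
  · exact disjoint_left.mp (hX _ _ fun e => hj ⟨t + 1, e⟩) (mem_sdiff.mp h).1 hxj
  · obtain ⟨r, hr, -⟩ := C.exists_released hX h hD hxj
    exact hj ⟨r + 1, hr.symm⟩

theorem notMem_target_of_mem_H (C : PICycle v X) (hX : IsPartialAlloc X) {t s : ZMod C.k}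
    (hts : t ≠ s) {x : ι} (hH : x ∈ C.H t) (hD : x ∉ C.D t) : x ∉ C.target s := by
  intro hx
  obtain ⟨hx, hDs⟩ := mem_sdiff.mp hx
  rcases mem_union.mp hx with h | h
  · obtain ⟨hXs, hSs⟩ := mem_sdiff.mp h
    obtain ⟨r, hr, hxr⟩ := C.exists_released hX hH hD hXs
    obtain rfl : s = r := add_right_cancel (C.inj hr)
    exact (mem_union.mp hxr).elim hSs hDs
  · exact disjoint_left.mp (C.H_pairwise t s hts) hH h

theorem disjoint_target (C : PICycle v X) (hX : IsPartialAlloc X) {t s : ZMod C.k}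
    (hts : t ≠ s) : Disjoint (C.target t) (C.target s) := by
  refine disjoint_left.mpr fun x hxt hxs => ?_
  obtain ⟨ht, hDt⟩ := mem_sdiff.mp hxt
  obtain ⟨hs, hDs⟩ := mem_sdiff.mp hxs
  rcases mem_union.mp ht with h | h
  · rcases mem_union.mp hs with h' | h'
    · exact disjoint_left.mp (hX _ _ fun e => hts (add_right_cancel (C.inj e)))
        (mem_sdiff.mp h).1 (mem_sdiff.mp h').1
    · exact C.notMem_target_of_mem_H hX hts.symm h' hDs hxt
  · exact C.notMem_target_of_mem_H hX hts h hDt hxs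

theorem isPartialAlloc_reallocate (C : PICycle v X) (hX : IsPartialAlloc X) :
    IsPartialAlloc C.reallocate := by
  intro i j hij
  by_cases hi : ∃ t, C.a t = i <;> by_cases hj : ∃ t, C.a t = j
  · obtain ⟨t, rfl⟩ := hi
    obtain ⟨s, rfl⟩ := hj
    rw [reallocate_apply, reallocate_apply]
    exact C.disjoint_target hX fun e => hij (congrArg C.a e)
  · obtain ⟨t, rfl⟩ := hi
    rw [reallocate_apply, C.reallocate_of_notMem hj]
    exact C.disjoint_target_bundle hX t hj
  · obtain ⟨t, rfl⟩ := hj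
    rw [reallocate_apply, C.reallocate_of_notMem hi]
    exact (C.disjoint_target_bundle hX t hi).symm
  · rw [C.reallocate_of_notMem hi, C.reallocate_of_notMem hj]
    exact hX i j hij

theorem lt_reallocate (C : PICycle v X) (t : ZMod C.k) :
    v (C.a t) (X (C.a t)) < v (C.a t) (C.reallocate (C.a t)) := by
  rw [reallocate_apply]
  exact C.envies t

theorem le_reallocate (C : PICycle v X) (i : Fin n) : v i (X i) ≤ v i (C.reallocate i) := by
  by_cases hi : ∃ t, C.a t = i
  · obtain ⟨t, rfl⟩ := hi
    exact (C.lt_reallocate t).le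
  · rw [C.reallocate_of_notMem hi]

theorem isEFX_reallocate (C : PICycle v X) (hEFX : IsEFX v X) : IsEFX v C.reallocate := by
  rintro i j hij ⟨h, hh, hlt⟩
  replace hlt := (C.le_reallocate i).trans_lt hlt
  by_cases hj : ∃ t, C.a t = j
  · obtain ⟨t, rfl⟩ := hj
    rw [reallocate_apply] at hh hlt
    exact C.no_strong t i ⟨h, hh, hlt⟩
  · rw [C.reallocate_of_notMem hj] at hh hlt
    exact hEFX i j hij ⟨h, hh, hlt⟩

end PICycle

/-- If the champion graph of a partial EFX allocation `X` contains a
Pareto improvable cycle `C`, then there exists a partial EFX allocation `Y` that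
Pareto dominates `X`, and every agent on the cycle is strictly better off in `Y`. -/
theorem pi_cycle_gives_pareto_dominating_efx
    {ι : Type*} [DecidableEq ι] [Fintype ι] {n : ℕ}
    (v : Fin n → Finset ι → ℝ) (hval : ∀ i, IsValuation (v i))
    (X : Fin n → Finset ι) (hX : IsPartialAlloc X) (hEFX : IsEFX v X)
    (C : PICycle v X) :
    ∃ Y : Fin n → Finset ι, IsPartialAlloc Y ∧ IsEFX v Y ∧ ParetoDominates v Y X ∧
      ∀ t : ZMod C.k, v (C.a t) (X (C.a t)) < v (C.a t) (Y (C.a t)) := by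
  exact ⟨C.reallocate, C.isPartialAlloc_reallocate hX, C.isEFX_reallocate hEFX,
    ⟨C.le_reallocate, C.a 0, C.lt_reallocate 0⟩, C.lt_reallocate⟩

end FairDivision
end
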